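/- Suppose the sequence (a_j) has Property (★), i.e. max_{1≤j≤n−1} s_n(j)/H_n(j) → 0 as n → ∞. Then the fast Leja points are good for polynomial interpolation on [0,1]: for every complex-valued function f that is holomorphic on an open neighborhood of [0,1] in ℂ, the Lagrange interpolation polynomials L_n f (the unique polynomial of degree at most n with L_n f(a_j) = f(a_j) for j = 0, …, n) converge uniformly to f on [0,1] as n → ∞. -/

import Mathlib

open Filter

/-- `p_n(x) = ∏_{j=0}^{n-1} (x - a_j)`. -/
noncomputable def lejaPoly (a : ℕ → ℝ) (n : ℕ) (x : ℝ) : ℝ :=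
  ∏ j ∈ Finset.range n, (x - a j)

/-- The candidate set `M_n`: midpoints `(x+y)/2` of pairs `x < y` of points among
`a₀, …, a_{n-1}` with no `a_l` (`l < n`) strictly between them. -/
def midCandidates (a : ℕ → ℝ) (n : ℕ) : Set ℝ :=
  {m | ∃ i j, i < n ∧ j < n ∧ a i < a j ∧
    (∀ l, l < n → ¬(a i < a l ∧ a l < a j)) ∧ m = (a i + a j) / 2}

/-- Half-gap `s_n(j) = (ζ_{nj} + ζ_{n(j+1)})/2 - ζ_{nj}` of the sorted row. -/
noncomputable def sgap (ζ : ℕ → ℕ → ℝ) (n j : ℕ) : ℝ :=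
  (ζ n j + ζ n (j + 1)) / 2 - ζ n j

/-- `H_n(j) = ((1/n) ∑_{k=1}^n 1/|m_{nj} - ζ_{nk}|)⁻¹` for the sorted row. -/
noncomputable def Hfun (ζ : ℕ → ℕ → ℝ) (n j : ℕ) : ℝ :=
  ((1 / (n : ℝ)) * ∑ k ∈ Finset.Icc 1 n,
      1 / |(ζ n j + ζ n (j + 1)) / 2 - ζ n k|)⁻¹

/-- A sequence with one-sided bounded increments and subquadratic partial sums is sublinear. -/
theorem eventually_le_mul_of_sum_le {b : ℕ → ℝ} {c : ℝ} (hb : ∀ n, 0 ≤ b n)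
    (hstep : ∀ n, b (n + 1) ≤ b n + c)
    (hsum : ∀ η > 0, ∀ᶠ n : ℕ in atTop, ∑ k ∈ Finset.range n, b k ≤ η * (n : ℝ) ^ 2)
    {δ : ℝ} (hδ : 0 < δ) : ∀ᶠ n : ℕ in atTop, b n ≤ δ * n := by
  obtain ⟨d, hcd, hδd⟩ : ∃ d, c ≤ d ∧ δ ≤ d := ⟨max c δ, le_max_left _ _, le_max_right _ _⟩
  have hd : 0 < d := hδ.trans_le hδd
  have hdec : ∀ i n, b (n + i) ≤ b n + d * i := by
    intro i n
    induction i with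
    | zero => simp
    | succ i ih =>
      have := hstep (n + i)
      push_cast
      rw [← add_assoc]
      linarith
  have hη : 0 < δ ^ 2 / (32 * d) := by positivity
  filter_upwards [(tendsto_add_atTop_nat 1).eventually (hsum _ hη), eventually_ge_atTop 1]
    with n hn hn1
  by_contra! hlt
  have hn0 : (1 : ℝ) ≤ n := by exact_mod_cast hn1
  set m := ⌊δ * n / (2 * d)⌋₊ with hm
  have hm1 : (m : ℝ) ≤ δ * n / (2 * d) := Nat.floor_le (by positivity)
  have hm2 : δ * n / (2 * d) < m + 1 := Nat.lt_floor_add_one _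
  have hmn : m ≤ n := by
    have : (m : ℝ) ≤ n := by
      refine hm1.trans ?_
      rw [div_le_iff₀ (by positivity)]
      nlinarith
    exact_mod_cast this
  have hlow : ∀ k ∈ Finset.Ico (n - m) (n + 1), δ * n / 2 ≤ b k := by
    intro k hk
    rw [Finset.mem_Ico] at hk
    have h1 := hdec (n - k) k
    rw [Nat.add_sub_cancel' (by omega)] at h1
    have h2 : ((n - k : ℕ) : ℝ) ≤ m := by exact_mod_cast (by omega : n - k ≤ m)
    have h3 : d * ((n - k : ℕ) : ℝ) ≤ d * (δ * n / (2 * d)) :=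
      mul_le_mul_of_nonneg_left (h2.trans hm1) hd.le
    have h4 : d * (δ * n / (2 * d)) = δ * n / 2 := by field_simp
    linarith
  have hcard : (Finset.Ico (n - m) (n + 1)).card = m + 1 := by
    rw [Nat.card_Ico]; omega
  have h5 := Finset.card_nsmul_le_sum _ _ _ hlow
  rw [hcard, nsmul_eq_mul] at h5
  have h6 : ∑ k ∈ Finset.Ico (n - m) (n + 1), b k ≤ ∑ k ∈ Finset.range (n + 1), b k := by
    refine Finset.sum_le_sum_of_subset_of_nonneg ?_ fun i _ _ => hb i
    intro k hk
    rw [Finset.mem_Ico] at hk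
    exact Finset.mem_range.2 hk.2
  have h7 : δ * n / (2 * d) * (δ * n / 2) < (m + 1) * (δ * n / 2) :=
    mul_lt_mul_of_pos_right hm2 (by positivity)
  have h8 : δ ^ 2 / (32 * d) * ((n : ℝ) + 1) ^ 2 ≤ δ ^ 2 / (32 * d) * (4 * n ^ 2) := by
    refine mul_le_mul_of_nonneg_left ?_ hη.le
    nlinarith
  have h9 : δ * n / (2 * d) * (δ * n / 2) = 2 * (δ ^ 2 / (32 * d) * (4 * n ^ 2)) := by
    field_simp; ring
  have h10 : 0 < δ ^ 2 / (32 * d) * (4 * (n : ℝ) ^ 2) := by positivity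
  push_cast at hn h5
  linarith

/-- The Vandermonde determinant of points of `[0, 1]` is controlled by the capacity `1 / 4`. -/
theorem prod_abs_lejaPoly_le {a : ℕ → ℝ} (hmem : ∀ j, a j ∈ Set.Icc (0 : ℝ) 1) (n : ℕ) :
    ∏ k ∈ Finset.range n, |lejaPoly a k (a k)| ≤
      n.factorial * ∏ k ∈ Finset.range n, (2 / 4 ^ k : ℝ) := by
  classical
  let Q : ℕ → Polynomial ℝ := fun k =>
    (Polynomial.Chebyshev.T ℝ k).comp (Polynomial.C 2 * Polynomial.X + Polynomial.C (-1))
  have hlin : (Polynomial.C (2 : ℝ) * Polynomial.X + Polynomial.C (-1)).natDegree = 1 :=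
    Polynomial.natDegree_linear two_ne_zero
  have hQdeg : ∀ k, (Q k).natDegree = k := by
    intro k
    simp only [Q, Polynomial.natDegree_comp, hlin, Polynomial.Chebyshev.natDegree_T]
    simp
  have hQlead : ∀ k, (Q k).leadingCoeff = 2 ^ (k - 1) * 2 ^ k := by
    intro k
    simp only [Q]
    rw [Polynomial.leadingCoeff_comp (by rw [hlin]; exact one_ne_zero),
      Polynomial.Chebyshev.leadingCoeff_T, Polynomial.leadingCoeff_linear two_ne_zero,
      Polynomial.Chebyshev.natDegree_T]
    simp
  have hQpos : ∀ k, 0 < (Q k).leadingCoeff := by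
    intro k; rw [hQlead]; positivity
  have hQinv : ∀ k, ((Q k).leadingCoeff)⁻¹ ≤ 2 / 4 ^ k := by
    intro k
    rw [hQlead, inv_eq_one_div, div_le_div_iff₀ (by positivity) (by positivity)]
    rcases k with _ | k
    · norm_num
    · rw [Nat.add_sub_cancel, show (4 : ℝ) = 2 * 2 by norm_num, mul_pow, pow_succ]
      apply le_of_eq; ring
  have hQev : ∀ k, ∀ x ∈ Set.Icc (0 : ℝ) 1, |(Q k).eval x| ≤ 1 := by
    intro k x hx
    simp only [Q, Polynomial.eval_comp]
    apply Polynomial.Chebyshev.abs_eval_T_real_le_one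
    simp only [Polynomial.eval_add, Polynomial.eval_mul, Polynomial.eval_C, Polynomial.eval_X]
    rw [abs_le]
    constructor <;> linarith [hx.1, hx.2]
  let P : Fin n → Polynomial ℝ := fun k => Polynomial.C ((Q k).leadingCoeff)⁻¹ * Q k
  have hVP := Matrix.det_eval_matrixOfPolynomials_eq_det_vandermonde (fun i : Fin n => a i) P
    (fun i => by
      simp only [P]
      rw [Polynomial.natDegree_C_mul (inv_ne_zero (hQpos _).ne'), hQdeg])
    (fun i => by
      simp only [P, Polynomial.Monic]
      rw [Polynomial.leadingCoeff_mul, Polynomial.leadingCoeff_C, inv_mul_cancel₀ (hQpos _).ne'])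
  have hscale : (Matrix.of fun i j : Fin n => (P j).eval (a i)).det =
      (∏ j : Fin n, ((Q j).leadingCoeff)⁻¹) *
        (Matrix.of fun i j : Fin n => (Q j).eval (a i)).det := by
    rw [← Matrix.det_mul_row]
    simp only [P, Polynomial.eval_mul, Polynomial.eval_C, Matrix.of_apply]
  have hdet : |(Matrix.of fun i j : Fin n => (Q j).eval (a i)).det| ≤ n.factorial := by
    have := Matrix.det_le (abv := IsAbsoluteValue.toAbsoluteValue (abs : ℝ → ℝ)) (x := 1)
      (A := Matrix.of fun i j : Fin n => (Q j).eval (a i)) (fun i j => hQev _ _ (hmem _))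
    simpa using this
  have hV : ∏ k ∈ Finset.range n, |lejaPoly a k (a k)| =
      |(Matrix.vandermonde fun i : Fin n => a i).det| := by
    have h1 : (Matrix.vandermonde fun i : Fin n => a i).det =
        ∏ k ∈ Finset.range n, lejaPoly a k (a k) := by
      rw [Matrix.det_vandermonde, ← Fin.prod_univ_eq_prod_range (fun k => lejaPoly a k (a k)) n,
        Finset.prod_comm' (t' := Finset.univ) (s' := fun j => Finset.Iio j)
          (by intro x y; simp)]
      refine Finset.prod_congr rfl fun j _ => ?_
      rw [lejaPoly, ← Nat.Iio_eq_range, ← Fin.map_valEmbedding_Iio, Finset.prod_map]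
      rfl
    rw [h1, Finset.abs_prod]
  rw [hV, hVP, hscale, abs_mul, mul_comm]
  refine mul_le_mul hdet ?_ (abs_nonneg _) (by positivity)
  rw [Finset.abs_prod, ← Finset.prod_range fun k => |((Q k).leadingCoeff)⁻¹|]
  refine Finset.prod_le_prod (fun _ _ => abs_nonneg _) fun k _ => ?_
  rw [abs_of_pos (inv_pos.2 (hQpos k))]
  exact hQinv k

/-- The quadratic `1 + (2 - 4 * t) * u + u²`, which equals `4 * u * (z(u) - t)` for the Joukowski
parametrisation `z(u) = (2 + u + u⁻¹) / 4` of the complement of `[0, 1]`. -/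
noncomputable def jquad (t : ℝ) (u : ℂ) : ℂ := 1 + (2 - 4 * (t : ℂ)) * u + u ^ 2

/-- The Joukowski map of the punctured unit disc onto the complement of `[0, 1]`. -/
noncomputable def joukowski (u : ℂ) : ℂ := (2 + u + u⁻¹) / 4

theorem joukowski_sub_eq {u : ℂ} (hu : u ≠ 0) (t : ℝ) :
    joukowski u - t = jquad t u / (4 * u) := by
  rw [joukowski, jquad]; field_simp; ring

theorem joukowski_of_norm_eq_one {u : ℂ} (hu : ‖u‖ = 1) :
    joukowski u = (((1 + u.re) / 2 : ℝ) : ℂ) := by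
  have h : u⁻¹ = (starRingEnd ℂ) u := Complex.inv_eq_conj hu
  rw [joukowski, h, add_assoc, Complex.add_conj]
  push_cast; ring

theorem half_one_add_re_mem_Icc {u : ℂ} (hu : ‖u‖ = 1) : (1 + u.re) / 2 ∈ Set.Icc (0 : ℝ) 1 := by
  have := Complex.abs_re_le_norm u
  rw [hu, abs_le] at this
  constructor <;> linarith [this.1, this.2]

theorem norm_jquad_of_norm_eq_one {u : ℂ} (hu : ‖u‖ = 1) (t : ℝ) :
    ‖jquad t u‖ = 4 * |(1 + u.re) / 2 - t| := by
  have hu0 : u ≠ 0 := by rintro rfl; simp at hu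
  have h := joukowski_sub_eq hu0 t
  rw [joukowski_of_norm_eq_one hu, eq_div_iff (by simpa using hu0)] at h
  rw [← h, norm_mul, ← Complex.ofReal_sub, Complex.norm_real, norm_mul, hu, Real.norm_eq_abs]
  norm_num [mul_comm]

theorem exists_exp_eq_jquad {t : ℝ} (ht : t ∈ Set.Icc (0 : ℝ) 1) :
    ∃ g : ℂ → ℂ, DifferentiableOn ℂ g (Metric.ball 0 1) ∧ g 0 = 0 ∧
      ∀ u ∈ Metric.ball (0 : ℂ) 1, Complex.exp (g u) = jquad t u := by
  set θ := Real.arccos (2 * t - 1)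
  have hcos : Real.cos θ = 2 * t - 1 := Real.cos_arccos (by linarith [ht.1]) (by linarith [ht.2])
  have hre : ∀ (s : ℝ), ∀ u ∈ Metric.ball (0 : ℂ) 1,
      1 - Complex.exp (s * Complex.I) * u ∈ Complex.slitPlane := by
    intro s u hu
    rw [mem_ball_zero_iff] at hu
    left
    have h1 := Complex.re_le_norm (Complex.exp (s * Complex.I) * u)
    rw [norm_mul, Complex.norm_exp_ofReal_mul_I, one_mul] at h1
    simp only [Complex.sub_re, Complex.one_re]
    linarith
  refine ⟨fun u => Complex.log (1 - Complex.exp (θ * Complex.I) * u) +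
    Complex.log (1 - Complex.exp ((-θ : ℝ) * Complex.I) * u), ?_, by simp, fun u hu => ?_⟩
  · refine DifferentiableOn.add ?_ ?_
    · exact DifferentiableOn.clog (by fun_prop) (hre θ)
    · exact DifferentiableOn.clog (by fun_prop) (hre (-θ))
  · rw [Complex.exp_add, Complex.exp_log (Complex.slitPlane_ne_zero (hre θ u hu)),
      Complex.exp_log (Complex.slitPlane_ne_zero (hre (-θ) u hu)), jquad]
    have h1 : Complex.exp (θ * Complex.I) * Complex.exp ((-θ : ℝ) * Complex.I) = 1 := by
      rw [← Complex.exp_add]; simp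
    have h2 : Complex.exp (θ * Complex.I) + Complex.exp ((-θ : ℝ) * Complex.I) =
        4 * t - 2 := by
      have := Complex.two_cos (θ : ℂ)
      rw [← Complex.ofReal_cos, hcos] at this
      push_cast at this ⊢
      rw [← this]; ring
    linear_combination (-u) * h2 + u ^ 2 * h1

theorem differentiable_prod_jquad (a : ℕ → ℝ) (n : ℕ) :
    Differentiable ℂ fun u => ∏ j ∈ Finset.range n, jquad (a j) u := by
  unfold jquad
  fun_prop

theorem norm_prod_jquad_of_norm_eq_one {u : ℂ} (hu : ‖u‖ = 1) (a : ℕ → ℝ) (n : ℕ) :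
    ‖∏ j ∈ Finset.range n, jquad (a j) u‖ = 4 ^ n * |lejaPoly a n ((1 + u.re) / 2)| := by
  rw [norm_prod, lejaPoly, Finset.abs_prod]
  simp_rw [norm_jquad_of_norm_eq_one hu, Finset.prod_mul_distrib]
  simp

theorem norm_prod_jquad_le {a : ℕ → ℝ} {n : ℕ} {K : ℝ}
    (h : ∀ x ∈ Set.Icc (0 : ℝ) 1, 4 ^ n * |lejaPoly a n x| ≤ K) {u : ℂ} (hu : ‖u‖ ≤ 1) :
    ‖∏ j ∈ Finset.range n, jquad (a j) u‖ ≤ K := by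
  refine Complex.norm_le_of_forall_mem_frontier_norm_le (U := Metric.ball 0 1)
    Metric.isBounded_ball (differentiable_prod_jquad a n).diffContOnCl (fun z hz => ?_) ?_
  · rw [frontier_ball _ one_ne_zero, mem_sphere_zero_iff_norm] at hz
    rw [norm_prod_jquad_of_norm_eq_one hz]
    exact h _ (half_one_add_re_mem_Icc hz)
  · rw [closure_ball _ one_ne_zero]
    simpa using hu

/-- A monic polynomial of degree `n` has sup norm at least `4⁻ⁿ` on `[0, 1]`. -/
theorem one_le_of_forall_lejaPoly_le {a : ℕ → ℝ} {n : ℕ} {K : ℝ}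
    (h : ∀ x ∈ Set.Icc (0 : ℝ) 1, 4 ^ n * |lejaPoly a n x| ≤ K) : 1 ≤ K := by
  have := norm_prod_jquad_le h (u := 0) (by simp)
  simpa [jquad] using this

/-- A Harnack-type lower bound off `[0, 1]` for polynomials that are almost extremal. -/
theorem exp_neg_le_norm_prod_jquad {a : ℕ → ℝ} (hmem : ∀ j, a j ∈ Set.Icc (0 : ℝ) 1) {n : ℕ}
    {B : ℝ} (hB : 0 < B)
    (h : ∀ x ∈ Set.Icc (0 : ℝ) 1, 4 ^ n * |lejaPoly a n x| ≤ Real.exp B) {u : ℂ} (hu : ‖u‖ < 1) :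
    Real.exp (-(2 * B * ‖u‖ / (1 - ‖u‖))) ≤ ‖∏ j ∈ Finset.range n, jquad (a j) u‖ := by
  choose g hg hg0 hgexp using fun j => exists_exp_eq_jquad (hmem j)
  have hexp : ∀ v ∈ Metric.ball (0 : ℂ) 1,
      Complex.exp (∑ j ∈ Finset.range n, g j v) = ∏ j ∈ Finset.range n, jquad (a j) v := by
    intro v hv
    rw [Complex.exp_sum]
    exact Finset.prod_congr rfl fun j _ => hgexp j v hv
  have hu' : u ∈ Metric.ball (0 : ℂ) 1 := mem_ball_zero_iff.2 hu
  have hbc := Complex.borelCaratheodory_zero (f := fun v => ∑ j ∈ Finset.range n, g j v) hB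
    (DifferentiableOn.fun_sum fun j _ => hg j) (fun v hv => by
      have h1 := norm_prod_jquad_le h (mem_ball_zero_iff.1 hv).le
      rw [← hexp v hv, Complex.norm_exp, Real.exp_le_exp] at h1
      exact h1) one_pos hu' (by simp [hg0])
  rw [← hexp u hu', Complex.norm_exp, Real.exp_le_exp]
  have := Complex.abs_re_le_norm (∑ j ∈ Finset.range n, g j u)
  linarith [(abs_le.1 this).1]

/-- The Property (★) quantity controls the sup norm of `p_n` by its value at the next point. -/
theorem abs_lejaPoly_le_mul_exp {a : ℕ → ℝ}
    (hinj : Function.Injective a) (ha0 : a 0 = 0) (ha1 : a 1 = 1) {n : ℕ} (hn : 2 ≤ n)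
    (hleja : ∀ m ∈ midCandidates a n, |lejaPoly a n m| ≤ |lejaPoly a n (a n)|)
    {ζ : ℕ → ℕ → ℝ} (hζmono : ∀ j k, 1 ≤ j → j < k → k ≤ n → ζ n j < ζ n k)
    (hζimage : (Finset.Icc 1 n).image (ζ n) = (Finset.range n).image a)
    {x : ℝ} (hx : x ∈ Set.Icc (0 : ℝ) 1) :
    |lejaPoly a n x| ≤ |lejaPoly a n (a n)| *
      Real.exp (n * ⨆ j ∈ Finset.Icc 1 (n - 1), sgap ζ n j / Hfun ζ n j) := by
  by_cases hzero : lejaPoly a n x = 0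
  · rw [hzero, abs_zero]; positivity
  have hnode : ∀ k, 1 ≤ k → k ≤ n → ∃ i < n, a i = ζ n k := by
    intro k h1 h2
    have : ζ n k ∈ (Finset.range n).image a := by
      rw [← hζimage]; exact Finset.mem_image_of_mem _ (Finset.mem_Icc.2 ⟨h1, h2⟩)
    simpa using this
  have hidx : ∀ i < n, ∃ k, 1 ≤ k ∧ k ≤ n ∧ ζ n k = a i := by
    intro i hi
    have : a i ∈ (Finset.Icc 1 n).image (ζ n) := by
      rw [hζimage]; exact Finset.mem_image_of_mem _ (Finset.mem_range.2 hi)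
    simpa [and_assoc] using this
  have hmono : ∀ j k, 1 ≤ j → j ≤ k → k ≤ n → ζ n j ≤ ζ n k := by
    intro j k h1 h2 h3
    rcases h2.eq_or_lt with rfl | h
    · exact le_rfl
    · exact (hζmono j k h1 h h3).le
  have hζinj : Set.InjOn (ζ n) (Finset.Icc 1 n : Finset ℕ) := by
    intro j hj k hk hjk
    simp only [Finset.coe_Icc, Set.mem_Icc] at hj hk
    rcases lt_trichotomy j k with h | h | h
    · exact absurd hjk (hζmono j k hj.1 h hk.2).ne
    · exact h
    · exact absurd hjk (hζmono k j hk.1 h hj.2).ne'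
  have hne : ∀ i < n, a i ≠ x := by
    intro i hi h
    exact hzero (Finset.prod_eq_zero (Finset.mem_range.2 hi) (by rw [h, sub_self]))
  obtain ⟨j, hj1, hjn, hjx, hxj⟩ :
      ∃ j, 1 ≤ j ∧ j ≤ n - 1 ∧ ζ n j ≤ x ∧ x ≤ ζ n (j + 1) := by
    have hex : ∃ k, 1 ≤ k ∧ k ≤ n ∧ x ≤ ζ n k := by
      obtain ⟨k, h1, h2, h3⟩ := hidx 1 (by omega)
      exact ⟨k, h1, h2, by rw [h3, ha1]; exact hx.2⟩
    classical
    obtain ⟨h1, h2, h3⟩ := Nat.find_spec hex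
    have hmin := fun m => Nat.find_min hex (m := m)
    generalize Nat.find hex = k at *
    obtain ⟨i, hi1, hin, hi⟩ := hidx 0 (by omega)
    have hk1 : k ≠ 1 := by
      rintro rfl
      have h4 := hmono 1 i le_rfl hi1 hin
      rw [hi, ha0] at h4
      have : x = 0 := le_antisymm (h3.trans h4) hx.1
      exact hne 0 (by omega) (by rw [ha0, this])
    refine ⟨k - 1, by omega, by omega, ?_, by rwa [Nat.sub_add_cancel h1]⟩
    have := hmin (k - 1) (by omega)
    push Not at this
    exact (this (by omega) (by omega)).le
  set m := (ζ n j + ζ n (j + 1)) / 2 with hm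
  have hlt : ζ n j < ζ n (j + 1) := hζmono j (j + 1) hj1 (by omega) (by omega)
  have hmcand : m ∈ midCandidates a n := by
    obtain ⟨i, hi, hi'⟩ := hnode j hj1 (by omega)
    obtain ⟨i₂, hi₂, hi₂'⟩ := hnode (j + 1) (by omega) (by omega)
    refine ⟨i, i₂, hi, hi₂, by rw [hi', hi₂']; exact hlt, ?_, by rw [hi', hi₂']⟩
    rintro l hl ⟨h1, h2⟩
    obtain ⟨k, hk1, hk2, hk⟩ := hidx l hl
    rw [hi', ← hk] at h1
    rw [hi₂', ← hk] at h2
    rcases le_or_gt k j with h | h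
    · exact absurd h1 (hmono k j hk1 h (by omega)).not_gt
    · exact absurd h2 (hmono (j + 1) k (by omega) h hk2).not_gt
  have hmne : ∀ i < n, 0 < |m - a i| := by
    intro i hi
    obtain ⟨k, hk1, hk2, hk⟩ := hidx i hi
    rw [abs_pos, sub_ne_zero, ← hk]
    rcases le_or_gt k j with h | h
    · have := hmono k j hk1 h (by omega)
      exact ne_of_gt (by linarith)
    · have := hmono (j + 1) k (by omega) h hk2
      exact ne_of_lt (by linarith)
  have hs : sgap ζ n j = m - ζ n j := rfl
  have hs0 : 0 < sgap ζ n j := by rw [hs]; linarith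
  have hxm : |x - m| ≤ sgap ζ n j := by
    rw [hs, abs_le]; constructor <;> linarith
  have hsum : ∑ i ∈ Finset.range n, sgap ζ n j / |m - a i| = n * (sgap ζ n j / Hfun ζ n j) := by
    have h1 : ∑ k ∈ Finset.Icc 1 n, 1 / |m - ζ n k| = ∑ i ∈ Finset.range n, 1 / |m - a i| := by
      rw [← Finset.sum_image (f := fun y => 1 / |m - y|) hζinj, hζimage,
        Finset.sum_image hinj.injOn]
    have hn0 : (n : ℝ) ≠ 0 := by positivity
    rw [Hfun, ← hm, h1, div_inv_eq_mul, Finset.mul_sum, Finset.mul_sum, Finset.mul_sum]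
    refine Finset.sum_congr rfl fun i _ => ?_
    field_simp
  have hsup : sgap ζ n j / Hfun ζ n j ≤
      ⨆ j ∈ Finset.Icc 1 (n - 1), sgap ζ n j / Hfun ζ n j := by
    refine le_ciSup_of_le ?_ j ?_
    · refine Set.Finite.bddAbove (Set.Finite.subset
        (((Finset.Icc 1 (n - 1)).image fun j => sgap ζ n j / Hfun ζ n j) ∪ {0}).finite_toSet ?_)
      rintro _ ⟨i, rfl⟩
      by_cases hi : i ∈ Finset.Icc 1 (n - 1)
      · simp only [hi, ciSup_unique, Finset.coe_union, Finset.coe_image]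
        exact Or.inl ⟨i, hi, rfl⟩
      · simp [hi]
    · have hj : j ∈ Finset.Icc 1 (n - 1) := Finset.mem_Icc.2 ⟨hj1, hjn⟩
      simp [hj]
  have hfac : ∀ i ∈ Finset.range n, |x - a i| ≤ |m - a i| * Real.exp (sgap ζ n j / |m - a i|) := by
    intro i hi
    have hpos := hmne i (Finset.mem_range.1 hi)
    calc |x - a i| ≤ |x - m| + |m - a i| := abs_sub_le _ _ _
      _ ≤ |m - a i| * (sgap ζ n j / |m - a i| + 1) := by
        rw [mul_add, mul_div_cancel₀ _ hpos.ne']; linarith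
      _ ≤ _ := mul_le_mul_of_nonneg_left (Real.add_one_le_exp _) hpos.le
  calc |lejaPoly a n x| = ∏ i ∈ Finset.range n, |x - a i| := by rw [lejaPoly, Finset.abs_prod]
    _ ≤ ∏ i ∈ Finset.range n, (|m - a i| * Real.exp (sgap ζ n j / |m - a i|)) :=
      Finset.prod_le_prod (fun _ _ => abs_nonneg _) hfac
    _ = |lejaPoly a n m| * Real.exp (n * (sgap ζ n j / Hfun ζ n j)) := by
      rw [Finset.prod_mul_distrib, ← Real.exp_sum, hsum, lejaPoly, Finset.abs_prod]
    _ ≤ _ := by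
      refine mul_le_mul (hleja m hmcand) ?_ (by positivity) (abs_nonneg _)
      exact Real.exp_le_exp.2 (mul_le_mul_of_nonneg_left hsup (by positivity))

/-- If the sup norm of `p_n` on `[0, 1]` is attained at `a_n` up to a subexponential factor,
then the `n`-th roots of the sup norms are asymptotically at most the capacity `1 / 4`. -/
theorem eventually_lejaPoly_le {a : ℕ → ℝ} (hmem : ∀ j, a j ∈ Set.Icc (0 : ℝ) 1)
    (hinj : Function.Injective a) {t : ℕ → ℝ} (ht : Tendsto t atTop (nhds 0))
    (hle : ∀ n, ∀ x ∈ Set.Icc (0 : ℝ) 1,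
      |lejaPoly a n x| ≤ |lejaPoly a n (a n)| * Real.exp (n * t n))
    {δ : ℝ} (hδ : 0 < δ) :
    ∀ᶠ n : ℕ in atTop, ∀ x ∈ Set.Icc (0 : ℝ) 1, 4 ^ n * |lejaPoly a n x| ≤ Real.exp (δ * n) := by
  have hcont : ∀ n, Continuous fun x => |lejaPoly a n x| := by
    intro n; unfold lejaPoly; fun_prop
  choose y hy hymax using fun n => (isCompact_Icc (a := (0 : ℝ)) (b := 1)).exists_isMaxOn
    (Set.nonempty_Icc.2 zero_le_one) (hcont n).continuousOn
  set M : ℕ → ℝ := fun n => 4 ^ n * |lejaPoly a n (y n)| with hM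
  have hMmax : ∀ n, ∀ x ∈ Set.Icc (0 : ℝ) 1, 4 ^ n * |lejaPoly a n x| ≤ M n := fun n x hx =>
    mul_le_mul_of_nonneg_left (hymax n hx) (by positivity)
  have hM1 : ∀ n, 1 ≤ M n := fun n => one_le_of_forall_lejaPoly_le (hMmax n)
  have hM0 : ∀ n, 0 < M n := fun n => one_pos.trans_le (hM1 n)
  have hstep : ∀ n, Real.log (M (n + 1)) ≤ Real.log (M n) + Real.log 4 := by
    intro n
    rw [← Real.log_mul (hM0 n).ne' (by norm_num)]
    refine Real.log_le_log (hM0 _) ?_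
    have h1 : |lejaPoly a (n + 1) (y (n + 1))| ≤ |lejaPoly a n (y (n + 1))| := by
      rw [lejaPoly, Finset.prod_range_succ, abs_mul]
      refine mul_le_of_le_one_right (abs_nonneg _) ?_
      have h2 := hy (n + 1)
      have h3 := hmem n
      rw [abs_le]; constructor <;> linarith [h2.1, h2.2, h3.1, h3.2]
    calc M (n + 1) ≤ 4 ^ (n + 1) * |lejaPoly a n (y (n + 1))| :=
          mul_le_mul_of_nonneg_left h1 (by positivity)
      _ = 4 ^ n * |lejaPoly a n (y (n + 1))| * 4 := by ring
      _ ≤ M n * 4 := mul_le_mul_of_nonneg_right (hMmax n _ (hy _)) (by norm_num)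
  have hpa : ∀ n, 0 < |lejaPoly a n (a n)| := by
    intro n
    rw [abs_pos, lejaPoly, Finset.prod_ne_zero_iff]
    intro i hi
    rw [sub_ne_zero]
    exact fun h => (Finset.mem_range.1 hi).ne' (hinj h)
  have hlogM : ∀ k, Real.log (M k) ≤
      k * Real.log 4 + Real.log |lejaPoly a k (a k)| + k * |t k| := by
    intro k
    have h1 : M k ≤ 4 ^ k * (|lejaPoly a k (a k)| * Real.exp (k * t k)) :=
      mul_le_mul_of_nonneg_left (hle k _ (hy k)) (by positivity)
    have h2 := Real.log_le_log (hM0 k) h1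
    rw [Real.log_mul (by positivity) (mul_ne_zero (hpa k).ne' (Real.exp_pos _).ne'),
      Real.log_mul (hpa k).ne' (Real.exp_pos _).ne', Real.log_exp, Real.log_pow] at h2
    have h3 : (k : ℝ) * t k ≤ k * |t k| :=
      mul_le_mul_of_nonneg_left (le_abs_self _) (Nat.cast_nonneg _)
    linarith
  have hsumlog : ∀ n : ℕ, ∑ k ∈ Finset.range n, Real.log |lejaPoly a k (a k)| ≤
      n * Real.log n + ∑ k ∈ Finset.range n, (Real.log 2 - k * Real.log 4) := by
    intro n
    have h1 := Real.log_le_log (Finset.prod_pos fun k _ => hpa k) (prod_abs_lejaPoly_le hmem n)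
    rw [Real.log_prod fun k _ => (hpa k).ne', Real.log_mul (by positivity)
      (Finset.prod_pos fun k _ => by positivity).ne', Real.log_prod fun k _ => by positivity] at h1
    have h2 : Real.log n.factorial ≤ n * Real.log n := by
      rw [← Real.log_pow]
      exact Real.log_le_log (by positivity) (by exact_mod_cast Nat.factorial_le_pow n)
    refine h1.trans (add_le_add h2 (Finset.sum_le_sum fun k _ => ?_))
    rw [Real.log_div (by norm_num) (by positivity), Real.log_pow]
  have hsum : ∀ n : ℕ, ∑ k ∈ Finset.range n, Real.log (M k) ≤
      n * Real.log n + n * Real.log 2 + n * ∑ k ∈ Finset.range n, |t k| := by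
    intro n
    have h1 := Finset.sum_le_sum fun k (_ : k ∈ Finset.range n) => hlogM k
    have h2 := hsumlog n
    rw [Finset.sum_add_distrib, Finset.sum_add_distrib] at h1
    rw [Finset.sum_sub_distrib] at h2
    simp only [Finset.sum_const, Finset.card_range, nsmul_eq_mul] at h2
    have h3 : ∑ k ∈ Finset.range n, (k : ℝ) * |t k| ≤ n * ∑ k ∈ Finset.range n, |t k| := by
      rw [Finset.mul_sum]
      refine Finset.sum_le_sum fun k hk => mul_le_mul_of_nonneg_right ?_ (abs_nonneg _)
      exact_mod_cast (Finset.mem_range.1 hk).le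
    linarith
  have hsmall : ∀ η > 0, ∀ᶠ n : ℕ in atTop,
      ∑ k ∈ Finset.range n, Real.log (M k) ≤ η * (n : ℝ) ^ 2 := by
    intro η hη
    have hces : Tendsto (fun n : ℕ => (n : ℝ)⁻¹ * ∑ k ∈ Finset.range n, |t k|) atTop (nhds 0) := by
      have := ht.abs
      rw [abs_zero] at this
      exact this.cesaro
    have hlog : ∀ᶠ n : ℕ in atTop, Real.log n ≤ η / 3 * n := by
      have := (Real.isLittleO_log_id_atTop.comp_tendsto tendsto_natCast_atTop_atTop).def
        (show (0 : ℝ) < η / 3 by positivity)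
      filter_upwards [this] with n hn
      simp only [Function.comp_apply, id_eq, Real.norm_eq_abs, Nat.abs_cast] at hn
      exact (le_abs_self _).trans hn
    have hlin : ∀ᶠ n : ℕ in atTop, Real.log 2 ≤ η / 3 * n :=
      (tendsto_natCast_atTop_atTop.const_mul_atTop (show (0 : ℝ) < η / 3 by positivity)
        ).eventually_ge_atTop _
    filter_upwards [hlog, hlin, hces.eventually_le_const (show (0 : ℝ) < η / 3 by positivity),
      eventually_gt_atTop 0] with n h1 h2 h3 hn
    have hn' : (0 : ℝ) < n := by exact_mod_cast hn
    rw [inv_mul_le_iff₀ hn'] at h3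
    refine (hsum n).trans ?_
    nlinarith
  filter_upwards [eventually_le_mul_of_sum_le (fun n => Real.log_nonneg (hM1 n)) hstep hsmall hδ]
    with n hn x hx
  refine (hMmax n x hx).trans ?_
  rwa [← Real.log_le_iff_le_exp (hM0 n)]

theorem jquad_ne_zero {t : ℝ} (ht : t ∈ Set.Icc (0 : ℝ) 1) {u : ℂ} (hu : ‖u‖ < 1) :
    jquad t u ≠ 0 := by
  obtain ⟨g, -, -, hg⟩ := exists_exp_eq_jquad ht
  rw [← hg u (mem_ball_zero_iff.2 hu)]
  exact Complex.exp_ne_zero _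

theorem joukowski_sub_ne_zero {t : ℝ} (ht : t ∈ Set.Icc (0 : ℝ) 1) {u : ℂ} (hu : ‖u‖ < 1)
    (hu0 : u ≠ 0) : joukowski u - t ≠ 0 := by
  rw [joukowski_sub_eq hu0]
  exact div_ne_zero (jquad_ne_zero ht hu) (mul_ne_zero (by norm_num) hu0)

theorem differentiableAt_joukowski {u : ℂ} (hu : u ≠ 0) : DifferentiableAt ℂ joukowski u := by
  unfold joukowski
  fun_prop (disch := exact hu)

/-- An open neighbourhood of `[0, 1]` contains the image of an annulus under the Joukowski map. -/
theorem exists_annulus_joukowski_mem {U : Set ℂ} (hU : IsOpen U)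
    (hIU : (Complex.ofReal '' Set.Icc (0 : ℝ) 1) ⊆ U) :
    ∃ r : ℝ, 0 < r ∧ r < 1 ∧ ∀ u : ℂ, r ≤ ‖u‖ → ‖u‖ ≤ 1 → joukowski u ∈ U := by
  have hV : IsOpen ({0}ᶜ ∩ joukowski ⁻¹' U) :=
    ContinuousOn.isOpen_inter_preimage (fun u hu =>
      (differentiableAt_joukowski hu).continuousAt.continuousWithinAt) isOpen_compl_singleton hU
  have hsub : Metric.sphere (0 : ℂ) 1 ⊆ {0}ᶜ ∩ joukowski ⁻¹' U := by
    intro u hu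
    rw [mem_sphere_zero_iff_norm] at hu
    refine ⟨by rintro rfl; simp at hu, hIU ?_⟩
    rw [joukowski_of_norm_eq_one hu]
    exact ⟨_, half_one_add_re_mem_Icc hu, rfl⟩
  obtain ⟨δ, hδ, hδU⟩ := (isCompact_sphere (0 : ℂ) 1).exists_thickening_subset_open hV hsub
  refine ⟨max (1 - δ / 2) (1 / 2), lt_max_of_lt_right (by norm_num),
    max_lt (by linarith) (by norm_num), fun u h1 h2 => ?_⟩
  have h3 : 1 - δ / 2 ≤ ‖u‖ := (le_max_left _ _).trans h1
  have h4 : 0 < ‖u‖ := lt_of_lt_of_le (by norm_num) ((le_max_right _ _).trans h1)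
  refine (hδU ((Metric.mem_thickening_iff).2 ⟨((‖u‖⁻¹ : ℝ) : ℂ) * u, ?_, ?_⟩)).2
  · rw [mem_sphere_zero_iff_norm, norm_mul, Complex.norm_real, norm_inv, norm_norm,
      inv_mul_cancel₀ h4.ne']
  · have h5 : u - ((‖u‖⁻¹ : ℝ) : ℂ) * u = ((1 - ‖u‖⁻¹ : ℝ) : ℂ) * u := by push_cast; ring
    rw [dist_eq_norm, h5, norm_mul, Complex.norm_real, Real.norm_eq_abs, abs_of_nonpos
      (by rw [sub_nonpos]; exact (one_le_inv₀ h4).2 h2)]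
    have h6 : -(1 - ‖u‖⁻¹) * ‖u‖ = 1 - ‖u‖ := by field_simp; ring
    rw [h6]; linarith

/-- The kernel of the Cauchy integral in the Joukowski coordinate. -/
noncomputable def joukowskiDeriv (u : ℂ) : ℂ := (1 - (u ^ 2)⁻¹) / 4

theorem circleIntegral_one_comp_joukowski_eq_zero (h : ℂ → ℂ) :
    (∮ u in C(0, 1), joukowskiDeriv u * h (joukowski u)) = 0 := by
  set k : ℝ → ℂ := fun θ => deriv (circleMap 0 1) θ •
    (joukowskiDeriv (circleMap 0 1 θ) * h (joukowski (circleMap 0 1 θ))) with hk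
  have hodd : ∀ θ, k (2 * Real.pi - θ) = -k θ := by
    intro θ
    have hinv : circleMap 0 1 (2 * Real.pi - θ) = (circleMap 0 1 θ)⁻¹ := by
      simp only [circleMap, zero_add, Complex.ofReal_one, one_mul, ← Complex.exp_neg]
      rw [Complex.exp_eq_exp_iff_exists_int]
      exact ⟨1, by push_cast; ring⟩
    have hne : circleMap 0 1 θ ≠ 0 := circleMap_ne_center one_ne_zero
    have hJ : joukowski (circleMap 0 1 θ)⁻¹ = joukowski (circleMap 0 1 θ) := by
      simp only [joukowski, inv_inv]; ring
    simp only [hk, deriv_circleMap, hinv, hJ, joukowskiDeriv, smul_eq_mul]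
    field_simp
    ring
  have h1 := intervalIntegral.integral_comp_sub_left (a := 0) (b := 2 * Real.pi) k (2 * Real.pi)
  simp only [hodd, intervalIntegral.integral_neg, sub_self, sub_zero] at h1
  have h2 : (∮ u in C(0, 1), joukowskiDeriv u * h (joukowski u)) = ∫ θ in 0..2 * Real.pi, k θ := rfl
  rw [h2]
  exact self_eq_neg.1 h1.symm

theorem circleIntegral_joukowskiDeriv_div {t r : ℝ} (ht : t ∈ Set.Icc (0 : ℝ) 1) (hr : 0 < r)
    (hr1 : r < 1) :
    (∮ u in C(0, r), joukowskiDeriv u * (joukowski u - t)⁻¹) = -(2 * Real.pi * Complex.I) := by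
  have hd : DifferentiableOn ℂ (fun u => (u ^ 2 - 1) / jquad t u) (Metric.ball 0 1) := by
    intro u hu
    have hne := jquad_ne_zero ht (mem_ball_zero_iff.1 hu)
    unfold jquad at hne ⊢
    have : DifferentiableAt ℂ (fun u : ℂ => (u ^ 2 - 1) / (1 + (2 - 4 * (t : ℂ)) * u + u ^ 2)) u := by
      fun_prop (disch := exact hne)
    exact this.differentiableWithinAt
  have h1 := (hd.diffContOnCl_ball (Metric.closedBall_subset_ball hr1)
    ).circleIntegral_sub_inv_smul (w := 0) (by simpa using hr)
  rw [circleIntegral.integral_congr hr.le (g := fun u => (u - 0)⁻¹ • ((u ^ 2 - 1) / jquad t u)) ?_,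
    h1]
  · simp [jquad]
  · intro u hu
    have hu' : ‖u‖ = r := mem_sphere_zero_iff_norm.1 hu
    have hu0 : u ≠ 0 := by rintro rfl; simp at hu'; exact hr.ne hu'
    have hne := jquad_ne_zero ht (hu'.trans_lt hr1)
    simp only [joukowski_sub_eq hu0, joukowskiDeriv, sub_zero, smul_eq_mul]
    field_simp

theorem continuousOn_joukowskiDeriv : ContinuousOn joukowskiDeriv {0}ᶜ := by
  intro u hu
  have : ContinuousAt joukowskiDeriv u := by
    unfold joukowskiDeriv
    fun_prop (disch := exact pow_ne_zero 2 hu)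
  exact this.continuousWithinAt

/-- Cauchy's integral formula on `[0, 1]` in the Joukowski coordinate. -/
theorem circleIntegral_joukowski_eq {f : ℂ → ℂ} {U : Set ℂ} (hU : IsOpen U)
    (hIU : (Complex.ofReal '' Set.Icc (0 : ℝ) 1) ⊆ U) (hf : DifferentiableOn ℂ f U) {r : ℝ}
    (hr : 0 < r) (hr1 : r < 1) (hrU : ∀ u : ℂ, r ≤ ‖u‖ → ‖u‖ ≤ 1 → joukowski u ∈ U)
    {t : ℝ} (ht : t ∈ Set.Icc (0 : ℝ) 1) :
    (∮ u in C(0, r), joukowskiDeriv u * f (joukowski u) * (joukowski u - t)⁻¹) =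
      -(2 * Real.pi * Complex.I) * f t := by
  have htU : (t : ℂ) ∈ U := hIU ⟨t, ht, rfl⟩
  have hd : DifferentiableOn ℂ (dslope f t) U :=
    (Complex.differentiableOn_dslope (hU.mem_nhds htU)).2 hf
  have hdA : ∀ u : ℂ, r ≤ ‖u‖ → ‖u‖ ≤ 1 →
      DifferentiableAt ℂ (fun u => joukowskiDeriv u * dslope f t (joukowski u)) u := by
    intro u h1 h2
    have hu0 : u ≠ 0 := by rintro rfl; simp at h1; linarith
    refine DifferentiableAt.mul ?_ ?_
    · unfold joukowskiDeriv
      fun_prop (disch := exact pow_ne_zero 2 hu0)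
    · exact (hd.differentiableAt (hU.mem_nhds (hrU u h1 h2))).comp u
        (differentiableAt_joukowski hu0)
  have h0 : (∮ u in C(0, r), joukowskiDeriv u * dslope f t (joukowski u)) = 0 := by
    refine Eq.trans (Eq.symm ?_) (circleIntegral_one_comp_joukowski_eq_zero (dslope f t))
    refine Complex.circleIntegral_eq_of_differentiable_on_annulus_off_countable hr hr1.le
      Set.countable_empty (fun u hu => ?_) (fun u hu => ?_)
    · simp only [Set.mem_sdiff, mem_closedBall_zero_iff, mem_ball_zero_iff, not_lt] at hu
      exact (hdA u hu.2 hu.1).continuousAt.continuousWithinAt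
    · simp only [Set.mem_sdiff, mem_closedBall_zero_iff, mem_ball_zero_iff, not_le] at hu
      exact hdA u hu.1.2.le hu.1.1.le
  have hS : ∀ u ∈ Metric.sphere (0 : ℂ) r, u ≠ 0 ∧ ‖u‖ = r := by
    intro u hu
    have hu' : ‖u‖ = r := mem_sphere_zero_iff_norm.1 hu
    exact ⟨by rintro rfl; simp at hu'; exact hr.ne hu', hu'⟩
  have hcJ : ContinuousOn joukowski (Metric.sphere 0 r) := fun u hu =>
    (differentiableAt_joukowski (hS u hu).1).continuousAt.continuousWithinAt
  have hcJ' : ContinuousOn joukowskiDeriv (Metric.sphere 0 r) :=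
    continuousOn_joukowskiDeriv.mono fun u hu => (hS u hu).1
  have hcinv : ContinuousOn (fun u => (joukowski u - t)⁻¹) (Metric.sphere 0 r) :=
    (hcJ.sub continuousOn_const).inv₀ fun u hu =>
      joukowski_sub_ne_zero ht ((hS u hu).2.trans_lt hr1) (hS u hu).1
  have hcf : ContinuousOn (fun u => f (joukowski u)) (Metric.sphere 0 r) :=
    hf.continuousOn.comp hcJ fun u hu => hrU u (hS u hu).2.ge ((hS u hu).2.trans_le hr1.le)
  rw [circleIntegral.integral_congr hr.le (g := fun u =>
      joukowskiDeriv u * f (joukowski u) * (joukowski u - t)⁻¹ -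
        f t * (joukowskiDeriv u * (joukowski u - t)⁻¹)) ?_,
    circleIntegral.integral_sub, circleIntegral.integral_const_mul,
    circleIntegral_joukowskiDeriv_div ht hr hr1, sub_eq_zero] at h0
  · rw [h0]; ring
  · exact ((hcJ'.mul hcf).mul hcinv).circleIntegrable hr.le
  · exact (continuousOn_const.mul (hcJ'.mul hcinv)).circleIntegrable hr.le
  · intro u hu
    have hne := joukowski_sub_ne_zero ht ((hS u hu).2.trans_lt hr1) (hS u hu).1
    simp only [dslope_of_ne f (sub_ne_zero.1 hne), slope_def_field]
    rw [div_eq_mul_inv]; ring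

/-- Lagrange interpolation of the Cauchy kernel. -/
theorem sum_basis_mul_inv_sub {ι F : Type*} [DecidableEq ι] [Field F] {s : Finset ι} {v : ι → F}
    (hv : Set.InjOn v s) {z : F} (hz : ∀ i ∈ s, z ≠ v i) {x : F} (hx : z ≠ x) :
    ∑ i ∈ s, (z - v i)⁻¹ * (Lagrange.basis s v i).eval x =
      (z - x)⁻¹ - (z - x)⁻¹ * (∏ i ∈ s, (x - v i)) * (∏ i ∈ s, (z - v i))⁻¹ := by
  have hP : (∏ i ∈ s, (z - v i)) ≠ 0 := Finset.prod_ne_zero_iff.2 fun i hi => sub_ne_zero.2 (hz i hi)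
  have hPz : (Lagrange.nodal s v).eval z = ∏ i ∈ s, (z - v i) := Lagrange.eval_nodal
  set P := ∏ i ∈ s, (z - v i) with hPdef
  obtain ⟨q, hq⟩ : Polynomial.X - Polynomial.C z ∣ Lagrange.nodal s v - Polynomial.C P := by
    rw [Polynomial.dvd_iff_isRoot]; simp [hPz]
  have hqe : ∀ y, (Lagrange.nodal s v).eval y - P = (y - z) * q.eval y := fun y => by
    simpa using congrArg (Polynomial.eval y) hq
  have hqd : q.degree < s.card := by
    by_cases hq0 : q = 0
    · rw [hq0, Polynomial.degree_zero]; exact WithBot.bot_lt_coe _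
    have h1 : (Lagrange.nodal s v - Polynomial.C P).degree ≤ s.card := by
      refine (Polynomial.degree_sub_le _ _).trans (max_le (by rw [Lagrange.degree_nodal]) ?_)
      exact Polynomial.degree_C_le.trans (by exact_mod_cast Nat.zero_le _)
    rw [hq, Polynomial.degree_mul, Polynomial.degree_X_sub_C, Polynomial.degree_eq_natDegree hq0]
      at h1
    rw [Polynomial.degree_eq_natDegree hq0]
    norm_cast at h1 ⊢
    omega
  have hqi : q = Lagrange.interpolate s v fun i => P * (z - v i)⁻¹ := by
    refine Lagrange.eq_interpolate_of_eval_eq _ hv hqd fun i hi => ?_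
    have h2 := hqe (v i)
    rw [Lagrange.eval_nodal_at_node hi] at h2
    have h3 := sub_ne_zero.2 (hz i hi)
    field_simp
    linear_combination h2
  have h4 := hqe x
  have h5 := sub_ne_zero.2 hx
  rw [hqi, Lagrange.interpolate_apply, Polynomial.eval_finsetSum, Lagrange.eval_nodal] at h4
  simp only [Polynomial.eval_mul, Polynomial.eval_C, mul_assoc, ← Finset.mul_sum] at h4
  set S := ∑ i ∈ s, (z - v i)⁻¹ * (Lagrange.basis s v i).eval x
  clear_value S
  field_simp
  linear_combination h4

/-- Hermite's remainder formula in the Joukowski coordinate. -/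
theorem eval_sub_eq_circleIntegral {f : ℂ → ℂ} {U : Set ℂ} (hU : IsOpen U)
    (hIU : (Complex.ofReal '' Set.Icc (0 : ℝ) 1) ⊆ U) (hf : DifferentiableOn ℂ f U) {r : ℝ}
    (hr : 0 < r) (hr1 : r < 1) (hrU : ∀ u : ℂ, r ≤ ‖u‖ → ‖u‖ ≤ 1 → joukowski u ∈ U)
    {a : ℕ → ℝ} (hmem : ∀ j, a j ∈ Set.Icc (0 : ℝ) 1) (hinj : Function.Injective a) {n : ℕ}
    {L : Polynomial ℂ} (hd : L.degree < n) (hL : ∀ j < n, L.eval (a j : ℂ) = f (a j))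
    {x : ℝ} (hx : x ∈ Set.Icc (0 : ℝ) 1) :
    L.eval (x : ℂ) - f x = (2 * Real.pi * Complex.I)⁻¹ • ∮ u in C(0, r),
      joukowskiDeriv u * f (joukowski u) * (joukowski u - x)⁻¹ *
        ((∏ j ∈ Finset.range n, ((x : ℂ) - a j)) *
          (∏ j ∈ Finset.range n, (joukowski u - a j))⁻¹) := by
  have hv : Set.InjOn (fun j => (a j : ℂ)) (Finset.range n) :=
    (Complex.ofReal_injective.comp hinj).injOn
  have hS : ∀ u ∈ Metric.sphere (0 : ℂ) r, u ≠ 0 ∧ ‖u‖ = r := by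
    intro u hu
    have hu' : ‖u‖ = r := mem_sphere_zero_iff_norm.1 hu
    exact ⟨by rintro rfl; simp at hu'; exact hr.ne hu', hu'⟩
  have hne : ∀ {t : ℝ}, t ∈ Set.Icc (0 : ℝ) 1 → ∀ u ∈ Metric.sphere (0 : ℂ) r,
      joukowski u - t ≠ 0 := fun ht u hu =>
    joukowski_sub_ne_zero ht ((hS u hu).2.trans_lt hr1) (hS u hu).1
  have hcJ : ContinuousOn joukowski (Metric.sphere 0 r) := fun u hu =>
    (differentiableAt_joukowski (hS u hu).1).continuousAt.continuousWithinAt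
  have hcf : ContinuousOn (fun u => joukowskiDeriv u * f (joukowski u)) (Metric.sphere 0 r) :=
    (continuousOn_joukowskiDeriv.mono fun u hu => (hS u hu).1).mul
      (hf.continuousOn.comp hcJ fun u hu => hrU u (hS u hu).2.ge ((hS u hu).2.trans_le hr1.le))
  have hci : ∀ {t : ℝ}, t ∈ Set.Icc (0 : ℝ) 1 → CircleIntegrable
      (fun u => joukowskiDeriv u * f (joukowski u) * (joukowski u - t)⁻¹) 0 r := fun ht =>
    (hcf.mul ((hcJ.sub continuousOn_const).inv₀ (hne ht))).circleIntegrable hr.le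
  have hC := fun {t : ℝ} (ht : t ∈ Set.Icc (0 : ℝ) 1) =>
    circleIntegral_joukowski_eq hU hIU hf hr hr1 hrU ht
  have hLx : L.eval (x : ℂ) = ∑ j ∈ Finset.range n,
      (Lagrange.basis (Finset.range n) (fun j => (a j : ℂ)) j).eval (x : ℂ) * f (a j) := by
    rw [Lagrange.eq_interpolate_of_eval_eq (r := fun j => f (a j)) hv
      (by simpa using hd) fun j hj => hL j (Finset.mem_range.1 hj)]
    simp [Lagrange.interpolate_apply, Polynomial.eval_finsetSum, mul_comm]
  have key : (∮ u in C(0, r), joukowskiDeriv u * f (joukowski u) * (joukowski u - x)⁻¹ *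
        ((∏ j ∈ Finset.range n, ((x : ℂ) - a j)) *
          (∏ j ∈ Finset.range n, (joukowski u - a j))⁻¹)) =
      -(2 * Real.pi * Complex.I) * f x - ∑ j ∈ Finset.range n,
        (Lagrange.basis (Finset.range n) (fun j => (a j : ℂ)) j).eval (x : ℂ) *
          (-(2 * Real.pi * Complex.I) * f (a j)) := by
    simp only [← hC hx, ← hC (hmem _), ← circleIntegral.integral_const_mul]
    rw [← circleIntegral.integral_fun_sum, ← circleIntegral.integral_sub (hci hx)]
    · refine circleIntegral.integral_congr hr.le fun u hu => ?_
      have h1 := sum_basis_mul_inv_sub hv (z := joukowski u)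
        (fun j _ => sub_ne_zero.1 (hne (hmem j) u hu)) (sub_ne_zero.1 (hne hx u hu))
      have h2 : ∑ j ∈ Finset.range n,
          (Lagrange.basis (Finset.range n) (fun j => (a j : ℂ)) j).eval (x : ℂ) *
            (joukowskiDeriv u * f (joukowski u) * (joukowski u - a j)⁻¹) =
          joukowskiDeriv u * f (joukowski u) * ∑ j ∈ Finset.range n, (joukowski u - a j)⁻¹ *
            (Lagrange.basis (Finset.range n) (fun j => (a j : ℂ)) j).eval (x : ℂ) := by
        rw [Finset.mul_sum]
        exact Finset.sum_congr rfl fun j _ => by ring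
      simp only [h2, h1]
      ring
    · exact CircleIntegrable.fun_sum _ fun j _ => (hci (hmem j)).const_fun_smul
    · exact fun j _ => (hci (hmem j)).const_fun_smul
  rw [key, hLx, smul_eq_mul, Finset.sum_congr rfl fun j _ => mul_left_comm _ _ _,
    ← Finset.mul_sum, ← mul_sub, ← mul_assoc, mul_neg, inv_mul_cancel₀ Complex.two_pi_I_ne_zero]
  ring

theorem norm_prod_mul_inv_prod_le {a : ℕ → ℝ} (hmem : ∀ j, a j ∈ Set.Icc (0 : ℝ) 1) {n : ℕ}
    {B : ℝ} (hB : 0 < B)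
    (h : ∀ x ∈ Set.Icc (0 : ℝ) 1, 4 ^ n * |lejaPoly a n x| ≤ Real.exp B)
    {u : ℂ} (hu0 : u ≠ 0) (hu : ‖u‖ < 1) {x : ℝ} (hx : x ∈ Set.Icc (0 : ℝ) 1) :
    ‖(∏ j ∈ Finset.range n, ((x : ℂ) - a j)) *
        (∏ j ∈ Finset.range n, (joukowski u - a j))⁻¹‖ ≤
      ‖u‖ ^ n * Real.exp (B * (1 + 2 * ‖u‖ / (1 - ‖u‖))) := by
  have hQ := exp_neg_le_norm_prod_jquad hmem hB h hu
  have h1 : ∏ j ∈ Finset.range n, (joukowski u - a j) =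
      (∏ j ∈ Finset.range n, jquad (a j) u) / (4 * u) ^ n := by
    simp_rw [joukowski_sub_eq hu0]
    rw [Finset.prod_div_distrib]; simp
  have h2 : ‖∏ j ∈ Finset.range n, ((x : ℂ) - a j)‖ = |lejaPoly a n x| := by
    rw [← Real.norm_eq_abs, ← Complex.norm_real]
    simp [lejaPoly]
  have h3 : ‖∏ j ∈ Finset.range n, jquad (a j) u‖⁻¹ ≤ Real.exp (2 * B * ‖u‖ / (1 - ‖u‖)) := by
    rw [inv_le_comm₀ ((Real.exp_pos _).trans_le hQ) (Real.exp_pos _), ← Real.exp_neg]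
    exact hQ
  rw [norm_mul, h2, h1, norm_inv, norm_div, norm_pow, norm_mul, Complex.norm_ofNat, inv_div,
    mul_pow]
  calc |lejaPoly a n x| * (4 ^ n * ‖u‖ ^ n / ‖∏ j ∈ Finset.range n, jquad (a j) u‖)
      = ‖u‖ ^ n * ((4 ^ n * |lejaPoly a n x|) * ‖∏ j ∈ Finset.range n, jquad (a j) u‖⁻¹) := by
        ring
    _ ≤ ‖u‖ ^ n * (Real.exp B * Real.exp (2 * B * ‖u‖ / (1 - ‖u‖))) := by
        gcongr
        exact h x hx
    _ = _ := by rw [← Real.exp_add]; ring_nf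

theorem norm_inv_joukowski_sub_le {u : ℂ} (hu0 : u ≠ 0) (hu : ‖u‖ < 1) {x : ℝ}
    (hx : x ∈ Set.Icc (0 : ℝ) 1) :
    ‖(joukowski u - x)⁻¹‖ ≤ 4 * ‖u‖ * Real.exp (4 * ‖u‖ / (1 - ‖u‖)) := by
  have h4 : ∀ y ∈ Set.Icc (0 : ℝ) 1, 4 ^ 1 * |lejaPoly (fun _ => x) 1 y| ≤ Real.exp 2 := by
    intro y hy
    have h1 : |y - x| ≤ 1 := abs_le.2 ⟨by linarith [hy.1, hx.2], by linarith [hy.2, hx.1]⟩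
    have h2 : (4 : ℝ) ≤ Real.exp 2 := by
      have h3 := Real.add_one_le_exp (1 : ℝ)
      have h5 : Real.exp 2 = Real.exp 1 * Real.exp 1 := by rw [← Real.exp_add]; norm_num
      nlinarith
    simp only [lejaPoly, Finset.range_one, Finset.prod_singleton]
    linarith
  have hQ := exp_neg_le_norm_prod_jquad (fun _ => hx) two_pos h4 hu
  rw [Finset.range_one, Finset.prod_singleton] at hQ
  rw [joukowski_sub_eq hu0, norm_inv, norm_div, norm_mul, Complex.norm_ofNat, inv_div,
    div_le_iff₀ ((Real.exp_pos _).trans_le hQ), mul_assoc]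
  refine le_mul_of_one_le_right (by positivity) ?_
  calc (1 : ℝ) = Real.exp (4 * ‖u‖ / (1 - ‖u‖)) * Real.exp (-(2 * 2 * ‖u‖ / (1 - ‖u‖))) := by
        rw [← Real.exp_add]; norm_num
    _ ≤ _ := by gcongr

/-- If the node polynomials have asymptotically minimal supremum norm on `[0, 1]`, interpolation
of holomorphic functions at these nodes converges uniformly on `[0, 1]`. -/
theorem tendstoUniformlyOn_eval_of_eventually_lejaPoly_le {a : ℕ → ℝ}
    (hmem : ∀ j, a j ∈ Set.Icc (0 : ℝ) 1) (hinj : Function.Injective a)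
    (ha : ∀ δ > 0, ∀ᶠ n : ℕ in atTop, ∀ x ∈ Set.Icc (0 : ℝ) 1,
      4 ^ n * |lejaPoly a n x| ≤ Real.exp (δ * n))
    {f : ℂ → ℂ} {U : Set ℂ} (hU : IsOpen U) (hIU : (Complex.ofReal '' Set.Icc (0 : ℝ) 1) ⊆ U)
    (hf : DifferentiableOn ℂ f U) {L : ℕ → Polynomial ℂ}
    (hL : ∀ n : ℕ, (L n).degree ≤ n ∧
      ∀ j ≤ n, (L n).eval ((a j : ℝ) : ℂ) = f ((a j : ℝ) : ℂ)) :
    TendstoUniformlyOn (fun n z => (L n).eval z) f atTop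
      (Complex.ofReal '' Set.Icc (0 : ℝ) 1) := by
  obtain ⟨r, hr, hr1, hrU⟩ := exists_annulus_joukowski_mem hU hIU
  have hS : ∀ u ∈ Metric.sphere (0 : ℂ) r, u ≠ 0 ∧ ‖u‖ = r := by
    intro u hu
    have hu' : ‖u‖ = r := mem_sphere_zero_iff_norm.1 hu
    exact ⟨by rintro rfl; simp at hu'; exact hr.ne hu', hu'⟩
  have hcf : ContinuousOn (fun u => joukowskiDeriv u * f (joukowski u)) (Metric.sphere 0 r) :=
    (continuousOn_joukowskiDeriv.mono fun u hu => (hS u hu).1).mul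
      (hf.continuousOn.comp (fun u hu =>
        (differentiableAt_joukowski (hS u hu).1).continuousAt.continuousWithinAt)
        fun u hu => hrU u (hS u hu).2.ge ((hS u hu).2.trans_le hr1.le))
  obtain ⟨A, hA⟩ := (isCompact_sphere (0 : ℂ) r).exists_bound_of_continuousOn hcf
  set c := 1 + 2 * r / (1 - r)
  have hc : 0 < c := add_pos one_pos (div_pos (by linarith) (by linarith))
  have hlog : Real.log r < 0 := Real.log_neg hr hr1
  set δ := -Real.log r / (2 * c) with hδdef
  have hδ : 0 < δ := div_pos (by linarith) (by linarith)
  have hpow : ∀ n : ℕ, r ^ n * Real.exp (δ * n * c) = Real.exp (Real.log r / 2) ^ n := by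
    intro n
    have h1 : r ^ n = Real.exp (n * Real.log r) := by rw [Real.exp_nat_mul, Real.exp_log hr]
    rw [h1, ← Real.exp_add, ← Real.exp_nat_mul, hδdef]
    congr 1
    field_simp
    ring
  set K := r * (A * (4 * r * Real.exp (4 * r / (1 - r))))
  have hlim : Tendsto (fun n : ℕ => K * Real.exp (Real.log r / 2) ^ n) atTop (nhds 0) := by
    simpa using (tendsto_pow_atTop_nhds_zero_of_lt_one (Real.exp_pos _).le
      (Real.exp_lt_one_iff.2 (by linarith : Real.log r / 2 < 0))).const_mul K
  rw [Metric.tendstoUniformlyOn_iff]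
  intro ε hε
  have hev := (tendsto_add_atTop_nat 1).eventually ((ha δ hδ).and (hlim.eventually_lt_const hε))
  filter_upwards [hev] with n hn
  rintro _ ⟨x, hx, rfl⟩
  rw [dist_comm, dist_eq_norm, eval_sub_eq_circleIntegral hU hIU hf hr hr1 hrU hmem hinj
    (n := n + 1) ((hL n).1.trans_lt (by exact_mod_cast n.lt_succ_self))
    (fun j hj => (hL n).2 j (Nat.lt_succ_iff.1 hj)) hx]
  refine lt_of_le_of_lt ?_ hn.2
  refine (circleIntegral.norm_two_pi_i_inv_smul_integral_le_of_norm_le_const hr.le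
    (C := A * (4 * r * Real.exp (4 * r / (1 - r))) * Real.exp (Real.log r / 2) ^ (n + 1))
    fun u hu => ?_).trans_eq (mul_assoc _ _ _).symm
  obtain ⟨hu0, hur⟩ := hS u hu
  have hu1 : ‖u‖ < 1 := hur.trans_lt hr1
  have h1 := norm_prod_mul_inv_prod_le hmem (by positivity) hn.1 hu0 hu1 hx
  have h2 := norm_inv_joukowski_sub_le hu0 hu1 hx
  rw [hur, hpow] at h1
  rw [hur] at h2
  rw [norm_mul, norm_mul]
  have hA0 : 0 ≤ A := (norm_nonneg _).trans (hA u hu)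
  gcongr
  exact hA u hu
/-- If the fast Leja points `(a_j)` on `[0,1]` (with midpoint
candidates) satisfy Property (★), then they are good for polynomial
interpolation on `[0,1]`: for every function `f` holomorphic on an open
neighborhood `U` of `[0,1]` in `ℂ`, the Lagrange interpolation polynomials
`L_n f` (the unique polynomial of degree at most `n` with
`L_n f(a_j) = f(a_j)` for `j = 0, …, n`) converge uniformly to `f` on `[0,1]`. -/
theorem stmt_12
    (a : ℕ → ℝ)
    (hmem : ∀ j, a j ∈ Set.Icc (0 : ℝ) 1)
    (hinj : Function.Injective a)
    (ha0 : a 0 = 0) (ha1 : a 1 = 1)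
    (hleja : ∀ n, 2 ≤ n → a n ∈ midCandidates a n ∧
      ∀ m ∈ midCandidates a n, |lejaPoly a n m| ≤ |lejaPoly a n (a n)|)
    (ζ : ℕ → ℕ → ℝ)
    (hζmono : ∀ n, 2 ≤ n → ∀ j k, 1 ≤ j → j < k → k ≤ n → ζ n j < ζ n k)
    (hζimage : ∀ n, 2 ≤ n →
      (Finset.Icc 1 n).image (ζ n) = (Finset.range n).image a)
    (hstar : Tendsto (fun n : ℕ => ⨆ j ∈ Finset.Icc 1 (n - 1), sgap ζ n j / Hfun ζ n j)
      atTop (nhds 0))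
    (f : ℂ → ℂ) (U : Set ℂ) (hU : IsOpen U)
    (hIU : (Complex.ofReal '' Set.Icc (0 : ℝ) 1) ⊆ U)
    (hf : DifferentiableOn ℂ f U)
    (L : ℕ → Polynomial ℂ)
    (hL : ∀ n : ℕ, (L n).degree ≤ n ∧
      ∀ j ≤ n, (L n).eval ((a j : ℝ) : ℂ) = f ((a j : ℝ) : ℂ)) :
    TendstoUniformlyOn (fun n z => (L n).eval z) f atTop
      (Complex.ofReal '' Set.Icc (0 : ℝ) 1) := by
  refine tendstoUniformlyOn_eval_of_eventually_lejaPoly_le hmem hinj (fun δ hδ => ?_) hU hIU hf hL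
  refine eventually_lejaPoly_le hmem hinj (t := fun n => if n < 2 then 0 else
    ⨆ j ∈ Finset.Icc 1 (n - 1), sgap ζ n j / Hfun ζ n j) ?_ (fun n x hx => ?_) hδ
  · refine hstar.congr' ?_
    filter_upwards [eventually_ge_atTop 2] with n hn
    rw [if_neg hn.not_gt]
  · rcases lt_or_ge n 2 with hn | hn
    · interval_cases n
      · simp [lejaPoly]
      · simpa [lejaPoly, ha0, ha1, abs_of_nonneg hx.1] using hx.2
    · rw [if_neg hn.not_gt]
      exact abs_lejaPoly_le_mul_exp hinj ha0 ha1 hn (hleja n hn).2 (hζmono n hn) (hζimage n hn) hx
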